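/- Minimum Modulus Principle: Let U ⊆ ℍ be an axially symmetric slice domain and let f : U → ℍ be slice regular. If |f| has a local minimum at a point p ∈ U, then either f(p) = 0 or f is constant on U. -/

import Mathlib

open Quaternion
open scoped InnerProductSpace

/-- The sphere `𝕊` of purely imaginary unit quaternions. -/
def QSphere : Set ℍ := {q : ℍ | q ^ 2 = -1}

/-- The complex plane `ℂ_I` through `1` and `I`. -/
def slicePlane (I : ℍ) : Set ℍ := {q : ℍ | ∃ x y : ℝ, q = (x : ℍ) + y • I}

/-- A real differentiable `f` is (left) slice regular on `U` if on every slice `U ∩ ℂ_I`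
it satisfies the Cauchy-Riemann equation `∂f/∂x + I ∂f/∂y = 0`. -/
def SliceRegularOn (f : ℍ → ℍ) (U : Set ℍ) : Prop :=
  DifferentiableOn ℝ f U ∧
    ∀ I ∈ QSphere, ∀ q ∈ U ∩ slicePlane I,
      fderiv ℝ f q 1 + I * fderiv ℝ f q I = 0

/-- A slice domain: a connected open set intersecting the real axis whose
intersection with each complex plane `ℂ_I` is connected. -/
def SliceDomain (U : Set ℍ) : Prop :=
  IsOpen U ∧ IsConnected U ∧ (∃ x : ℝ, (x : ℍ) ∈ U) ∧
    ∀ I ∈ QSphere, IsPreconnected (U ∩ slicePlane I)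

/-- `U` is axially symmetric if `x + Iy ∈ U` implies `x + Jy ∈ U` for all `J ∈ 𝕊`. -/
def AxiallySymmetric (U : Set ℍ) : Prop :=
  ∀ (x y : ℝ), ∀ I ∈ QSphere, ((x : ℍ) + y • I) ∈ U →
    ∀ J ∈ QSphere, ((x : ℍ) + y • J) ∈ U

open Filter Topology

/-- The point `x + yI` of the slice `ℂ_I` with complex coordinate `x + iy`. -/
noncomputable def slicePoint (I : ℍ) (z : ℂ) : ℍ := (z.re : ℍ) + z.im • I

theorem QSphere.mul_self {I : ℍ} (hI : I ∈ QSphere) : I * I = -1 := by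
  rw [← sq]; exact hI

theorem QSphere.neg_mem {I : ℍ} (hI : I ∈ QSphere) : -I ∈ QSphere := by
  simpa [QSphere] using hI

theorem QSphere.norm_eq_one {I : ℍ} (hI : I ∈ QSphere) : ‖I‖ = 1 := by
  have h : ‖I‖ ^ 2 = 1 := by rw [← norm_pow, show I ^ 2 = -1 from hI, norm_neg, norm_one]
  nlinarith [norm_nonneg I]

theorem QSphere.re_eq_zero {I : ℍ} (hI : I ∈ QSphere) : I.re = 0 := by
  rw [← Quaternion.sq_eq_neg_normSq, show I ^ 2 = -1 from hI,
    Quaternion.normSq_eq_norm_mul_self, QSphere.norm_eq_one hI]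
  simp

theorem QSphere.conj_mem {I u : ℍ} (hI : I ∈ QSphere) (hu : u ≠ 0) :
    u⁻¹ * I * u ∈ QSphere := by
  change (u⁻¹ * I * u) ^ 2 = -1
  calc (u⁻¹ * I * u) ^ 2 = u⁻¹ * I * (u * u⁻¹) * I * u := by rw [sq]; simp only [mul_assoc]
    _ = u⁻¹ * (I * I) * u := by rw [mul_inv_cancel₀ hu]; simp only [mul_assoc, one_mul]
    _ = -1 := by rw [QSphere.mul_self hI]; simp [inv_mul_cancel₀ hu]

theorem slicePoint_one (I : ℍ) : slicePoint I 1 = 1 := by simp [slicePoint]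

theorem slicePoint_add (I : ℍ) (z w : ℂ) :
    slicePoint I (z + w) = slicePoint I z + slicePoint I w := by
  simp [slicePoint, add_smul]; abel

theorem slicePoint_mul {I : ℍ} (hI : I ∈ QSphere) (z w : ℂ) :
    slicePoint I (z * w) = slicePoint I z * slicePoint I w :=
  (Complex.liftAux I (QSphere.mul_self hI)).map_mul z w

theorem slicePoint_commute (I : ℍ) (z : ℂ) : Commute (slicePoint I z) I :=
  (Quaternion.coe_commute z.re I).add_left ((Commute.refl I).smul_left z.im)

theorem norm_slicePoint {I : ℍ} (hI : I ∈ QSphere) (z : ℂ) : ‖slicePoint I z‖ = ‖z‖ := by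
  have h : ‖slicePoint I z‖ * ‖slicePoint I z‖ = ‖z‖ * ‖z‖ := by
    have h1 := QSphere.norm_eq_one hI
    have h2 : Quaternion.normSq I = 1 := by rw [Quaternion.normSq_eq_norm_mul_self, h1, one_mul]
    rw [← Quaternion.normSq_eq_norm_mul_self, slicePoint, Quaternion.normSq_add,
      ← sq ‖z‖, ← Complex.normSq_eq_norm_sq, Quaternion.normSq_smul, h2, Complex.normSq_apply]
    have h3 : Quaternion.normSq (z.re : ℍ) = z.re ^ 2 := Quaternion.normSq_coe _
    rw [h3]
    simp [QSphere.re_eq_zero hI]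
    ring
  exact (mul_self_inj (norm_nonneg _) (norm_nonneg _)).1 h

/-- The inclusion of the slice `ℂ_I` as a continuous real-linear map. -/
noncomputable def slicePointCLM (I : ℍ) : ℂ →L[ℝ] ℍ :=
  LinearMap.toContinuousLinearMap
    { toFun := slicePoint I
      map_add' := slicePoint_add I
      map_smul' := fun r z => by
        simp [slicePoint, mul_smul, Quaternion.smul_coe] }

@[simp]
theorem slicePointCLM_apply (I : ℍ) (z : ℂ) : slicePointCLM I z = slicePoint I z := rfl

theorem continuous_slicePoint (I : ℍ) : Continuous (slicePoint I) := (slicePointCLM I).continuous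

/-- Holomorphy at `z` for the complex structure on `ℍ` given by left multiplication by `I`. -/
def SliceHolomorphicAt (I : ℍ) (g : ℂ → ℍ) (z : ℂ) : Prop :=
  ∃ L : ℂ →L[ℝ] ℍ, HasFDerivAt g L z ∧ L Complex.I = I * L 1

namespace SliceHolomorphicAt

variable {I : ℍ} {g h : ℂ → ℍ} {z : ℂ}

theorem sub (hg : SliceHolomorphicAt I g z) (hh : SliceHolomorphicAt I h z) :
    SliceHolomorphicAt I (fun w => g w - h w) z := by
  obtain ⟨L, hL, hL'⟩ := hg
  obtain ⟨M, hM, hM'⟩ := hh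
  exact ⟨L - M, hL.sub hM, by simp [hL', hM', mul_sub]⟩

theorem const (c : ℍ) : SliceHolomorphicAt I (fun _ => c) z :=
  ⟨0, hasFDerivAt_const c z, by simp⟩

theorem slicePoint_mul (hI : I ∈ QSphere) {n : ℂ → ℂ} (hn : DifferentiableAt ℂ n z)
    (hg : SliceHolomorphicAt I g z) :
    SliceHolomorphicAt I (fun w => slicePoint I (n w) * g w) z := by
  obtain ⟨L, hL, hL'⟩ := hg
  have h1 : HasFDerivAt (fun w => slicePoint I (n w))
      ((slicePointCLM I).comp ((fderiv ℂ n z).restrictScalars ℝ)) z :=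
    (slicePointCLM I).hasFDerivAt.comp z (hn.hasFDerivAt.restrictScalars ℝ)
  refine ⟨_, h1.mul' hL, ?_⟩
  have h2 : fderiv ℂ n z Complex.I = Complex.I * fderiv ℂ n z 1 := by
    rw [← smul_eq_mul, ← map_smul]; simp
  have h3 : slicePoint I Complex.I = I := by simp [slicePoint]
  simp [h2, hL', _root_.slicePoint_mul hI, h3, mul_add]
  rw [← mul_assoc, (slicePoint_commute I (n z)).eq]
  simp [mul_assoc]

end SliceHolomorphicAt

/-- The complex normed space structure on `ℍ` given by left multiplication by `I`. -/
noncomputable abbrev sliceNormedSpace {I : ℍ} (hI : I ∈ QSphere) : NormedSpace ℂ ℍ where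
  toModule := Module.compHom ℍ (Complex.liftAux I (QSphere.mul_self hI)).toRingHom
  norm_smul_le z q := by
    change ‖slicePoint I z * q‖ ≤ _
    rw [norm_mul, norm_slicePoint hI]

theorem SliceHolomorphicAt.differentiableAt {I : ℍ} (hI : I ∈ QSphere) {g : ℂ → ℍ} {z : ℂ}
    (hg : SliceHolomorphicAt I g z) :
    letI := sliceNormedSpace hI
    DifferentiableAt ℂ g z := by
  obtain ⟨L, hL, hL'⟩ := hg
  let := sliceNormedSpace hI
  have key : HasDerivAt g (L 1) z := by
    rw [hasDerivAt_iff_isLittleO]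
    refine hL.isLittleO.congr_left fun w => ?_
    have h1 : L (w - z) = slicePoint I (w - z) * L 1 := by
      conv_lhs => rw [show w - z = (w - z).re • (1 : ℂ) + (w - z).im • Complex.I by
        apply Complex.ext <;> simp]
      rw [map_add, map_smul, map_smul, hL', slicePoint, add_mul, Quaternion.coe_mul_eq_smul,
        smul_mul_assoc]
    rw [h1]
    rfl
  exact key.differentiableAt

theorem SliceHolomorphicAt.eqOn_of_frequently_eq {I : ℍ} (hI : I ∈ QSphere) {g h : ℂ → ℍ}
    {D : Set ℂ} (hD : IsOpen D) (hD' : IsPreconnected D)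
    (hg : ∀ z ∈ D, SliceHolomorphicAt I g z) (hh : ∀ z ∈ D, SliceHolomorphicAt I h z)
    {z₀ : ℂ} (hz₀ : z₀ ∈ D) (hgh : ∃ᶠ z in 𝓝[≠] z₀, g z = h z) : Set.EqOn g h D := by
  let := sliceNormedSpace hI
  have analytic : ∀ k : ℂ → ℍ, (∀ z ∈ D, SliceHolomorphicAt I k z) → AnalyticOnNhd ℂ k D :=
    fun k hk => DifferentiableOn.analyticOnNhd
      (fun z hz => ((hk z hz).differentiableAt hI).differentiableWithinAt) hD
  exact (analytic g hg).eqOn_of_preconnected_of_frequently_eq (analytic h hh) hD' hz₀ hgh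

theorem SliceHolomorphicAt.eventually_eq_of_isLocalMax_norm {I : ℍ} (hI : I ∈ QSphere)
    {g : ℂ → ℍ} {z₀ : ℂ} (hg : ∀ᶠ z in 𝓝 z₀, SliceHolomorphicAt I g z)
    (hmax : IsLocalMax (norm ∘ g) z₀) : ∀ᶠ z in 𝓝 z₀, g z = g z₀ := by
  have strict : (Metric.sphere (0 : ℍ) 1).Pairwise fun x y => ‖x + y‖ ≠ 2 := by
    intro x hx y hy hxy h2
    rw [mem_sphere_zero_iff_norm] at hx hy
    have h := parallelogram_law_with_norm ℝ x y
    rw [h2, hx, hy] at h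
    have : ‖x - y‖ = 0 := by nlinarith [norm_nonneg (x - y)]
    exact hxy (sub_eq_zero.1 (norm_eq_zero.1 this))
  let := sliceNormedSpace hI
  have : @StrictConvexSpace ℝ ℍ _ _ _ NormedSpace.complexToReal :=
    @StrictConvexSpace.of_pairwise_sphere_norm_ne_two ℍ _ NormedSpace.complexToReal strict
  exact Complex.eventually_eq_of_isLocalMax_norm
    (hg.mono fun z hz => hz.differentiableAt hI) hmax

/-- The Cauchy-Riemann equations at `z` for the two components of the stem function `a + ib`. -/
def IsStemAt (a b : ℂ → ℍ) (z : ℂ) : Prop :=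
  ∃ A B : ℂ →L[ℝ] ℍ, HasFDerivAt a A z ∧ HasFDerivAt b B z ∧
    A Complex.I = -B 1 ∧ B Complex.I = A 1

/-- The value `|a|² - |b|² + 2i⟪a, b⟫` of the normal function of the stem value `a + ib`. -/
noncomputable def stemNorm (a b : ℍ) : ℂ := ⟨‖a‖ ^ 2 - ‖b‖ ^ 2, 2 * ⟪a, b⟫_ℝ⟩

theorem IsStemAt.sliceHolomorphicAt {a b : ℂ → ℍ} {z : ℂ} (h : IsStemAt a b z) {I : ℍ}
    (hI : I ∈ QSphere) : SliceHolomorphicAt I (fun w => a w + I * b w) z := by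
  obtain ⟨A, B, hA, hB, h1, h2⟩ := h
  refine ⟨_, hA.add (hB.const_mul I), ?_⟩
  simp [h1, h2, mul_add, ← mul_assoc, QSphere.mul_self hI, add_comm]

theorem IsStemAt.star {a b : ℂ → ℍ} {z : ℂ} (h : IsStemAt a b z) :
    IsStemAt (fun w => star (a w)) (fun w => star (b w)) z := by
  obtain ⟨A, B, hA, hB, h1, h2⟩ := h
  have : StarModule ℝ ℍ := ⟨fun r q => by ext <;> simp⟩
  exact ⟨_, _, hA.star, hB.star, by simp [h1], by simp [h2]⟩

theorem IsStemAt.differentiableAt_stemNorm {a b : ℂ → ℍ} {z : ℂ} (h : IsStemAt a b z) :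
    DifferentiableAt ℂ (fun w => stemNorm (a w) (b w)) z := by
  obtain ⟨A, B, hA, hB, h1, h2⟩ := h
  have hu := (hA.norm_sq).sub (hB.norm_sq)
  have hv := (hA.inner ℝ hB).const_mul 2
  have key := (Complex.ofRealCLM.hasFDerivAt.comp z hu).add
    ((Complex.ofRealCLM.hasFDerivAt.comp z hv).mul_const Complex.I)
  have heq : (fun w => stemNorm (a w) (b w)) =
      (fun w => ((‖a w‖ ^ 2 - ‖b w‖ ^ 2 : ℝ) : ℂ) + ((2 * ⟪a w, b w⟫_ℝ : ℝ) : ℂ) * Complex.I) := by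
    funext w
    exact Complex.mk_eq_add_mul_I _ _
  rw [heq, differentiableAt_complex_iff_differentiableAt_real]
  refine ⟨key.differentiableAt, ?_⟩
  erw [key.fderiv]
  apply Complex.ext <;>
    simp [h1, h2, real_inner_comm, fderivInnerCLM_apply, inner_neg_right, inner_neg_left] <;> ring

theorem star_mul_add_star_mul (a b : ℍ) :
    star b * a + star a * b = ((2 * ⟪a, b⟫_ℝ : ℝ) : ℍ) := by
  ext <;> simp [Quaternion.inner_def] <;> ring

theorem mul_star_add_mul_star (a b : ℍ) :
    b * star a + a * star b = ((2 * ⟪a, b⟫_ℝ : ℝ) : ℍ) := by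
  ext <;> simp [Quaternion.inner_def] <;> ring

theorem star_mul_self_eq_norm_sq (a : ℍ) : star a * a = ((‖a‖ ^ 2 : ℝ) : ℍ) := by
  rw [Quaternion.star_mul_self, Quaternion.normSq_eq_norm_mul_self, sq]

theorem self_mul_star_eq_norm_sq (a : ℍ) : a * star a = ((‖a‖ ^ 2 : ℝ) : ℍ) := by
  rw [Quaternion.self_mul_star, Quaternion.normSq_eq_norm_mul_self, sq]

theorem conjugate_mul_add {J : ℍ} (hJ : J ∈ QSphere) (a b : ℍ) :
    (star a + J * star b) * a + J * (star a + J * star b) * b = slicePoint J (stemNorm a b) := by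
  calc (star a + J * star b) * a + J * (star a + J * star b) * b
      = star a * a + J * (star b * a + star a * b) + J * J * (star b * b) := by noncomm_ring
    _ = slicePoint J (stemNorm a b) := by
      rw [star_mul_add_star_mul, star_mul_self_eq_norm_sq, star_mul_self_eq_norm_sq,
        QSphere.mul_self hJ, Quaternion.mul_coe_eq_smul, slicePoint, stemNorm]
      push_cast
      noncomm_ring

theorem mul_conjugate_add {I : ℍ} (hI : I ∈ QSphere) (a b : ℍ) :
    (a + I * b) * star a + I * (a + I * b) * star b = slicePoint I (stemNorm a b) := by
  calc (a + I * b) * star a + I * (a + I * b) * star b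
      = a * star a + I * (b * star a + a * star b) + I * I * (b * star b) := by noncomm_ring
    _ = slicePoint I (stemNorm a b) := by
      rw [mul_star_add_mul_star, self_mul_star_eq_norm_sq, self_mul_star_eq_norm_sq,
        QSphere.mul_self hI, Quaternion.mul_coe_eq_smul, slicePoint, stemNorm]
      push_cast
      noncomm_ring

/-- A local minimum of `u ↦ |ua + Iub| / |u|` at `1` is a global minimum. -/
theorem norm_mul_le_of_eventually {I a b : ℍ}
    (h : ∀ᶠ u in 𝓝 (1 : ℍ), ‖u‖ * ‖a + I * b‖ ≤ ‖u * a + I * u * b‖) (v : ℍ) :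
    ‖v‖ * ‖a + I * b‖ ≤ ‖v * a + I * v * b‖ := by
  have hlim : ∀ w : ℍ, Tendsto (fun t : ℝ => 1 + t • w) (𝓝[≠] 0) (𝓝 1) := fun w => by
    have : Continuous fun t : ℝ => 1 + t • w := by fun_prop
    simpa using (this.tendsto 0).mono_left nhdsWithin_le_nhds
  have hne : ∀ᶠ t : ℝ in 𝓝[≠] 0, t ≠ 0 := eventually_mem_nhdsWithin
  obtain ⟨t, h1, h2, ht⟩ :=
    (((hlim v).eventually h).and (((hlim (-v)).eventually h).and hne)).exists
  have expand : ∀ w : ℍ, (1 + t • w) * a + I * (1 + t • w) * b =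
      (a + I * b) + t • (w * a + I * w * b) := fun w => by
    simp only [mul_add, add_mul, mul_smul_comm, smul_mul_assoc, smul_add, one_mul, mul_one]
    abel
  have square : ∀ w : ℍ, ‖1 + t • w‖ * ‖a + I * b‖ ≤ ‖(1 + t • w) * a + I * (1 + t • w) * b‖ →
      (1 + 2 * (t * ⟪1, w⟫_ℝ) + t ^ 2 * ‖w‖ ^ 2) * ‖a + I * b‖ ^ 2 ≤
        ‖a + I * b‖ ^ 2 + 2 * (t * ⟪a + I * b, w * a + I * w * b⟫_ℝ) +
          t ^ 2 * ‖w * a + I * w * b‖ ^ 2 := fun w hw => by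
    have := pow_le_pow_left₀ (by positivity) hw 2
    rw [expand, mul_pow, norm_add_sq_real 1, norm_add_sq_real (a + I * b), inner_smul_right,
      inner_smul_right, norm_smul, norm_smul, mul_pow, mul_pow, Real.norm_eq_abs, sq_abs,
      norm_one, one_pow] at this
    exact this
  have h1' := square v h1
  have h2' := square (-v) h2
  have hneg : -v * a + I * -v * b = -(v * a + I * v * b) := by noncomm_ring
  rw [hneg, inner_neg_right, inner_neg_right, norm_neg, norm_neg] at h2'
  have ht2 : 0 < t ^ 2 := by positivity
  have : (‖v‖ * ‖a + I * b‖) ^ 2 ≤ ‖v * a + I * v * b‖ ^ 2 := by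
    refine le_of_mul_le_mul_left ?_ ht2
    nlinarith
  exact le_of_sq_le_sq this (norm_nonneg _)

/-- Any two imaginary units are conjugate. -/
theorem QSphere.exists_intertwiner {I J : ℍ} (hI : I ∈ QSphere) (hJ : J ∈ QSphere) :
    ∃ v : ℍ, v ≠ 0 ∧ I * v = v * J := by
  have key : ∀ e : ℍ, I * (e - I * e * J) = (e - I * e * J) * J := fun e => by
    have h1 : I * (e - I * e * J) = I * e - (I * I) * e * J := by noncomm_ring
    have h2 : (e - I * e * J) * J = e * J - I * e * (J * J) := by noncomm_ring
    rw [h1, h2, QSphere.mul_self hI, QSphere.mul_self hJ]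
    noncomm_ring
  by_contra! hcon
  have hzero : ∀ e : ℍ, e = I * e * J := fun e => by
    by_contra he
    exact hcon _ (sub_ne_zero.2 he) (key e)
  have hcomm : ∀ e : ℍ, I * e = e * I := fun e => by
    have h1 : I * J = 1 := by simpa using (hzero 1).symm
    have h2 : J = -I := by
      calc J = -(I * I) * J := by rw [QSphere.mul_self hI]; simp
        _ = -I * (I * J) := by noncomm_ring
        _ = -I := by rw [h1, mul_one]
    have h3 := hzero e
    rw [h2] at h3
    calc I * e = I * (I * e * -I) := by rw [← h3]
      _ = -(I * I) * e * I := by noncomm_ring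
      _ = e * I := by rw [QSphere.mul_self hI]; simp
  have h0 := QSphere.re_eq_zero hI
  have hn := congrArg (fun q : ℍ => q.re) (QSphere.mul_self hI)
  have comm_unit : ∀ e : ℍ, I.imI * e.imJ - I.imJ * e.imI = 0 ∧
      I.imK * e.imI - I.imI * e.imK = 0 ∧ I.imJ * e.imK - I.imK * e.imJ = 0 := fun e => by
    have h1 := congrArg (fun q : ℍ => q.imK) (hcomm e)
    have h2 := congrArg (fun q : ℍ => q.imJ) (hcomm e)
    have h3 := congrArg (fun q : ℍ => q.imI) (hcomm e)
    simp [h0] at h1 h2 h3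
    refine ⟨?_, ?_, ?_⟩ <;> linarith
  obtain ⟨h1, h2, -⟩ := comm_unit ⟨0, 1, 0, 0⟩
  obtain ⟨h3, -, -⟩ := comm_unit ⟨0, 0, 1, 0⟩
  simp [h0] at h1 h2 h3 hn
  simp [h1, h2, h3] at hn

theorem stemNorm_ne_zero {I a b : ℍ} (hI : I ∈ QSphere) (hne : a + I * b ≠ 0)
    (h : ∀ v : ℍ, ‖v‖ * ‖a + I * b‖ ≤ ‖v * a + I * v * b‖) : stemNorm a b ≠ 0 := by
  intro h0
  have hre : ‖a‖ ^ 2 - ‖b‖ ^ 2 = 0 := congrArg Complex.re h0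
  have him : ⟪a, b⟫_ℝ = 0 := by
    have : 2 * ⟪a, b⟫_ℝ = 0 := congrArg Complex.im h0
    linarith
  have hab : ‖a‖ = ‖b‖ :=
    (sq_eq_sq₀ (norm_nonneg a) (norm_nonneg b)).1 (sub_eq_zero.1 hre)
  have hb : b ≠ 0 := by
    rintro rfl
    simp at hab
    simp [hab] at hne
  have hJ : -(a * b⁻¹) ∈ QSphere := by
    change (-(a * b⁻¹)) ^ 2 = -1
    have hre0 : (-(a * b⁻¹)).re = 0 := by
      rw [Quaternion.inner_def] at him
      rw [show b⁻¹ = (Quaternion.normSq b)⁻¹ • star b from rfl]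
      simp only [mul_smul_comm, Quaternion.re_neg, Quaternion.re_smul, him, smul_zero, neg_zero]
    rw [Quaternion.sq_eq_neg_normSq.2 hre0, Quaternion.normSq_eq_norm_mul_self, norm_neg, norm_mul,
      norm_inv, hab, mul_inv_cancel₀ (norm_ne_zero_iff.2 hb)]
    simp
  obtain ⟨v, hv, hIv⟩ := QSphere.exists_intertwiner hI hJ
  have hzero : v * a + I * v * b = 0 := by
    rw [hIv]
    simp [mul_assoc, inv_mul_cancel₀ hb]
  have := h v
  rw [hzero, norm_zero] at this
  have : 0 < ‖v‖ * ‖a + I * b‖ := mul_pos (norm_pos_iff.2 hv) (norm_pos_iff.2 hne)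
  linarith

theorem QSphere.nonempty : QSphere.Nonempty := by
  refine ⟨((Complex.I : ℂ) : ℍ), ?_⟩
  change ((Complex.I : ℂ) : ℍ) ^ 2 = -1
  rw [sq, ← Quaternion.coeComplex_mul, Complex.I_mul_I]
  ext <;> simp

theorem exists_eq_slicePoint (q : ℍ) : ∃ I ∈ QSphere, ∃ z : ℂ, q = slicePoint I z := by
  by_cases h : q.im = 0
  · obtain ⟨I, hI⟩ := QSphere.nonempty
    refine ⟨I, hI, (q.re : ℂ), ?_⟩
    conv_lhs => rw [← Quaternion.re_add_im q, h]
    simp [slicePoint]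
  · have hn : ‖q.im‖ ≠ 0 := norm_ne_zero_iff.2 h
    refine ⟨‖q.im‖⁻¹ • q.im, ?_, ⟨q.re, ‖q.im‖⟩, ?_⟩
    · change (‖q.im‖⁻¹ • q.im) ^ 2 = -1
      rw [smul_pow, Quaternion.im_sq, Quaternion.normSq_eq_norm_mul_self, ← Quaternion.coe_neg,
        Quaternion.smul_coe, show ‖q.im‖⁻¹ ^ 2 * -(‖q.im‖ * ‖q.im‖) = -1 by field_simp]
      simp
    · rw [slicePoint, smul_smul, mul_inv_cancel₀ hn, one_smul, Quaternion.re_add_im]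

theorem slicePoint_conj (I : ℍ) (z : ℂ) :
    slicePoint I ((starRingEnd ℂ) z) = slicePoint (-I) z := by
  simp [slicePoint]

theorem slicePoint_ofReal (I : ℍ) (t : ℝ) : slicePoint I (t : ℂ) = t := by
  simp [slicePoint]

theorem AxiallySymmetric.slicePoint_mem_iff {U : Set ℍ} (hsym : AxiallySymmetric U) {I J : ℍ}
    (hI : I ∈ QSphere) (hJ : J ∈ QSphere) (z : ℂ) : slicePoint I z ∈ U ↔ slicePoint J z ∈ U :=
  ⟨fun h => hsym _ _ I hI h J hJ, fun h => hsym _ _ J hJ h I hI⟩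

theorem SliceDomain.isPreconnected_preimage {U : Set ℍ} (hU : SliceDomain U) {I : ℍ}
    (hI : I ∈ QSphere) : IsPreconnected (slicePoint I ⁻¹' U) := by
  let r : ℍ → ℂ := fun q => (q.re : ℂ) + (⟪q, I⟫_ℝ : ℂ) * Complex.I
  have hr : Continuous r := by
    have := Quaternion.continuous_re
    fun_prop
  have hleft : ∀ z, r (slicePoint I z) = z := fun z => by
    have h0 := QSphere.re_eq_zero hI
    have h1 : ⟪(z.re : ℍ), I⟫_ℝ = 0 := by simp [Quaternion.inner_def, h0]
    have h2 : ⟪slicePoint I z, I⟫_ℝ = z.im := by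
      rw [slicePoint, inner_add_left, h1, real_inner_smul_left, real_inner_self_eq_norm_sq,
        QSphere.norm_eq_one hI]
      ring
    have h3 : (slicePoint I z).re = z.re := by simp [slicePoint, h0]
    simp only [r, h2, h3, Complex.re_add_im]
  have himage : slicePoint I ⁻¹' U = r '' (U ∩ slicePlane I) := by
    ext z
    constructor
    · exact fun hz => ⟨slicePoint I z, ⟨hz, z.re, z.im, rfl⟩, hleft z⟩
    · rintro ⟨q, ⟨hq, x, y, rfl⟩, rfl⟩
      have := hleft ⟨x, y⟩
      simp only [slicePoint] at this
      rw [this]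
      exact hq
  rw [himage]
  exact (hU.2.2.2 I hI).image r hr.continuousOn

theorem SliceRegularOn.sliceHolomorphicAt {U : Set ℍ} (hU : IsOpen U) {f : ℍ → ℍ}
    (hf : SliceRegularOn f U) {I : ℍ} (hI : I ∈ QSphere) {z : ℂ} (hz : slicePoint I z ∈ U) :
    SliceHolomorphicAt I (fun w => f (slicePoint I w)) z := by
  have hd := (hf.1.differentiableAt (hU.mem_nhds hz)).hasFDerivAt
  refine ⟨_, hd.comp z (slicePointCLM I).hasFDerivAt, ?_⟩
  have hcr := hf.2 I hI _ ⟨hz, z.re, z.im, rfl⟩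
  have h1 : slicePoint I Complex.I = I := by simp [slicePoint]
  simp only [ContinuousLinearMap.comp_apply, slicePointCLM_apply, slicePoint_one, h1]
  rw [eq_neg_of_add_eq_zero_left hcr, mul_neg, ← mul_assoc, QSphere.mul_self hI]
  simp

theorem isStemAt_of_sliceHolomorphicAt {K : ℍ} (hK : K ∈ QSphere) {g : ℂ → ℍ} {z : ℂ}
    (h : SliceHolomorphicAt K g z) (h' : SliceHolomorphicAt K g ((starRingEnd ℂ) z)) :
    IsStemAt (fun w => (2⁻¹ : ℝ) • (g w + g ((starRingEnd ℂ) w)))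
      (fun w => (2⁻¹ : ℝ) • (-K * (g w - g ((starRingEnd ℂ) w)))) z := by
  obtain ⟨L, hL, hLI⟩ := h
  obtain ⟨M, hM, hMI⟩ := h'
  have hM' : HasFDerivAt (fun w => g ((starRingEnd ℂ) w))
      (M.comp (Complex.conjCLE : ℂ →L[ℝ] ℂ)) z :=
    HasFDerivAt.comp z (by simpa using hM) (Complex.conjCLE : ℂ →L[ℝ] ℂ).hasFDerivAt
  refine ⟨_, _, (hL.add hM').const_smul (2⁻¹ : ℝ),
    ((hL.sub hM').const_mul (-K)).const_smul (2⁻¹ : ℝ), ?_, ?_⟩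
  · simp [hLI, hMI, smul_sub, smul_add]
    abel
  · simp [hLI, hMI, mul_add, ← mul_assoc, QSphere.mul_self hK, add_comm]

/-- The representation formula: a slice regular function on an axially symmetric slice domain is
induced by a stem function. -/
theorem SliceRegularOn.exists_stem {U : Set ℍ} (hU : SliceDomain U) (hsym : AxiallySymmetric U)
    {f : ℍ → ℍ} (hf : SliceRegularOn f U) :
    ∃ (D : Set ℂ) (a b : ℂ → ℍ), IsOpen D ∧ IsPreconnected D ∧
      (∀ z ∈ D, (starRingEnd ℂ) z ∈ D) ∧
      (∀ z, a ((starRingEnd ℂ) z) = a z) ∧ (∀ z, b ((starRingEnd ℂ) z) = -b z) ∧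
      (∀ z ∈ D, IsStemAt a b z) ∧ (∀ I ∈ QSphere, ∀ z, slicePoint I z ∈ U ↔ z ∈ D) ∧
      ∀ I ∈ QSphere, ∀ z ∈ D, f (slicePoint I z) = a z + I * b z := by
  obtain ⟨K, hK⟩ := QSphere.nonempty
  have hDopen : IsOpen (slicePoint K ⁻¹' U) := hU.1.preimage (continuous_slicePoint K)
  have hDconj : ∀ z ∈ slicePoint K ⁻¹' U, (starRingEnd ℂ) z ∈ slicePoint K ⁻¹' U := fun z hz => by
    rw [Set.mem_preimage, slicePoint_conj, hsym.slicePoint_mem_iff (QSphere.neg_mem hK) hK]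
    exact hz
  have hstem := fun z (hz : z ∈ slicePoint K ⁻¹' U) => isStemAt_of_sliceHolomorphicAt hK
    (hf.sliceHolomorphicAt hU.1 hK hz) (hf.sliceHolomorphicAt hU.1 hK (hDconj z hz))
  refine ⟨slicePoint K ⁻¹' U, _, _, hDopen, hU.isPreconnected_preimage hK, hDconj, fun z => ?_,
    fun z => ?_, hstem, fun I hI z => hsym.slicePoint_mem_iff hI hK z, fun I hI => ?_⟩
  · simp [add_comm]
  · simp [mul_sub]
  · obtain ⟨x, hx⟩ := hU.2.2.1
    refine SliceHolomorphicAt.eqOn_of_frequently_eq hI hDopen (hU.isPreconnected_preimage hK)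
      (fun z hz => hf.sliceHolomorphicAt hU.1 hI ((hsym.slicePoint_mem_iff hI hK z).2 hz))
      (fun z hz => (hstem z hz).sliceHolomorphicAt hI) (z₀ := (x : ℂ))
      (by rwa [Set.mem_preimage, slicePoint_ofReal]) ?_
    have hlim : Tendsto (fun t : ℝ => (t : ℂ)) (𝓝[≠] x) (𝓝[≠] (x : ℂ)) :=
      Complex.continuous_ofReal.continuousAt.continuousWithinAt.tendsto_nhdsWithin
        fun t ht => by simpa using ht
    refine hlim.frequently (Frequently.of_forall fun t => ?_)
    rw [Complex.conj_ofReal, slicePoint_ofReal, slicePoint_ofReal, sub_self, mul_zero, smul_zero,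
      mul_zero, add_zero, ← two_smul ℝ (f t), smul_smul]
    norm_num

theorem stemNorm_neg_right (a b : ℍ) : stemNorm a (-b) = (starRingEnd ℂ) (stemNorm a b) := by
  apply Complex.ext <;> simp [stemNorm]

theorem stemNorm_smul_smul (x y : ℝ) (c : ℍ) :
    stemNorm (x • c) (y • c) = (‖c‖ ^ 2 : ℝ) * (⟨x, y⟩ : ℂ) ^ 2 := by
  rw [sq (⟨x, y⟩ : ℂ)]
  apply Complex.ext
  · rw [Complex.re_ofReal_mul]
    simp only [stemNorm, norm_smul, mul_pow, Real.norm_eq_abs, sq_abs, Complex.mul_re]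
    ring
  · rw [Complex.im_ofReal_mul]
    simp only [stemNorm, real_inner_smul_left, real_inner_smul_right, real_inner_self_eq_norm_sq,
      Complex.mul_im]
    ring

theorem eq_smul_of_conjugate_eq {J a b c : ℍ} (hJ : J ∈ QSphere) {n : ℂ}
    (h : star a + J * star b = slicePoint J n * c)
    (h' : star a - J * star b = slicePoint J ((starRingEnd ℂ) n) * c) :
    a = n.re • star c ∧ b = n.im • star c := by
  have hJ0 : J ≠ 0 := fun h0 => by simpa [h0] using QSphere.norm_eq_one hJ
  simp only [slicePoint, add_mul, Quaternion.coe_mul_eq_smul, smul_mul_assoc, Complex.conj_re,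
    Complex.conj_im, neg_smul, neg_mul] at h h'
  have ha : star a = n.re • c := by
    refine smul_right_injective ℍ (two_ne_zero (α := ℝ)) ?_
    change (2 : ℝ) • star a = (2 : ℝ) • n.re • c
    rw [two_smul, two_smul]
    calc star a + star a = (star a + J * star b) + (star a - J * star b) := by abel
      _ = n.re • c + n.re • c := by rw [h, h']; abel
  have hb : star b = n.im • c := by
    refine mul_left_cancel₀ hJ0 ?_
    rw [ha] at h
    rw [mul_smul_comm]
    exact add_left_cancel h
  have hstar : ∀ (r : ℝ) (q : ℍ), star (r • q) = r • star q := fun r q => by ext <;> simp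
  exact ⟨by rw [← star_star a, ha, hstar], by rw [← star_star b, hb, hstar]⟩

/-- If the conjugate of a stem function is, on one slice, a constant multiple of its normal
function near a point where the latter does not vanish, then the stem function is constant. -/
theorem exists_forall_stem_eq {D : Set ℂ} {a b : ℂ → ℍ} (hD : IsOpen D) (hD' : IsPreconnected D)
    (hconj : ∀ z ∈ D, (starRingEnd ℂ) z ∈ D) (ha : ∀ z, a ((starRingEnd ℂ) z) = a z)
    (hb : ∀ z, b ((starRingEnd ℂ) z) = -b z) (hstem : ∀ z ∈ D, IsStemAt a b z)
    {J c : ℍ} (hJ : J ∈ QSphere) {z₀ : ℂ} (hz₀ : z₀ ∈ D) (hn₀ : stemNorm (a z₀) (b z₀) ≠ 0)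
    (h : ∀ᶠ z in 𝓝 z₀, star (a z) + J * star (b z) = slicePoint J (stemNorm (a z) (b z)) * c) :
    ∃ d : ℍ, ∀ z ∈ D, a z = d ∧ b z = 0 := by
  have hdiff : ∀ z ∈ D, DifferentiableAt ℂ (fun w => stemNorm (a w) (b w)) z :=
    fun z hz => (hstem z hz).differentiableAt_stemNorm
  have hglobal : ∀ z ∈ D,
      star (a z) + J * star (b z) = slicePoint J (stemNorm (a z) (b z)) * c :=
    SliceHolomorphicAt.eqOn_of_frequently_eq hJ hD hD'
      (fun z hz => (hstem z hz).star.sliceHolomorphicAt hJ)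
      (fun z hz => (SliceHolomorphicAt.const c).slicePoint_mul hJ (hdiff z hz)) hz₀
      (h.filter_mono nhdsWithin_le_nhds).frequently
  have hab : ∀ z ∈ D, a z = (stemNorm (a z) (b z)).re • star c ∧
      b z = (stemNorm (a z) (b z)).im • star c := fun z hz => by
    refine eq_smul_of_conjugate_eq hJ (hglobal z hz) ?_
    have := hglobal _ (hconj z hz)
    rwa [ha, hb, stemNorm_neg_right, star_neg, mul_neg, ← sub_eq_add_neg] at this
  have hsq : ∀ z ∈ D, stemNorm (a z) (b z) =
      (‖star c‖ ^ 2 : ℝ) * stemNorm (a z) (b z) ^ 2 := fun z hz => by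
    rw [← stemNorm_smul_smul, ← (hab z hz).1, ← (hab z hz).2]
  have hlocal : ∀ᶠ z in 𝓝 z₀, stemNorm (a z) (b z) = ((‖star c‖ ^ 2)⁻¹ : ℝ) := by
    filter_upwards [hD.mem_nhds hz₀, (hdiff z₀ hz₀).continuousAt.eventually_ne hn₀] with z hz hnz
    have h1 : ((‖star c‖ ^ 2 : ℝ) : ℂ) * stemNorm (a z) (b z) = 1 := by
      refine mul_right_cancel₀ hnz ?_
      rw [one_mul, mul_assoc, ← sq, ← hsq z hz]
    rw [Complex.ofReal_inv]
    exact eq_inv_of_mul_eq_one_right h1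
  have hdiffOn : DifferentiableOn ℂ (fun w => stemNorm (a w) (b w)) D :=
    fun z hz => (hdiff z hz).differentiableWithinAt
  have hconst := (hdiffOn.analyticOnNhd hD).eqOn_of_preconnected_of_eventuallyEq
    (analyticOnNhd_const (v := (((‖star c‖ ^ 2)⁻¹ : ℝ) : ℂ))) hD' hz₀ hlocal
  refine ⟨(‖star c‖ ^ 2)⁻¹ • star c, fun z hz => ?_⟩
  have hz' : stemNorm (a z) (b z) = ((‖star c‖ ^ 2)⁻¹ : ℝ) := hconst hz
  have := hab z hz
  rw [hz', Complex.ofReal_re, Complex.ofReal_im, zero_smul] at this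
  exact this

/-- **Minimum Modulus Principle.** If `f` is slice regular on an axially symmetric slice
domain `U` and `|f|` has a local minimum at `p ∈ U`, then `f(p) = 0` or `f` is constant. -/
theorem minimum_modulus (U : Set ℍ) (hU : SliceDomain U) (hsym : AxiallySymmetric U)
    (f : ℍ → ℍ) (hf : SliceRegularOn f U) (p : ℍ) (hp : p ∈ U)
    (hmin : ∃ V ∈ nhds p, V ⊆ U ∧ ∀ q ∈ V, ‖f p‖ ≤ ‖f q‖) :
    f p = 0 ∨ ∀ q ∈ U, f q = f p := by
  rw [or_iff_not_imp_left]
  intro hfp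
  obtain ⟨D, a, b, hD, hD', hconj, ha, hb, hstem, hmem, hrep⟩ := hf.exists_stem hU hsym
  suffices h : ∃ d : ℍ, ∀ z ∈ D, a z = d ∧ b z = 0 by
    obtain ⟨d, hd⟩ := h
    have hfd : ∀ q ∈ U, f q = d := fun q hq => by
      obtain ⟨I, hI, z, rfl⟩ := exists_eq_slicePoint q
      have hz := (hmem I hI z).1 hq
      rw [hrep I hI z hz, (hd z hz).1, (hd z hz).2, mul_zero, add_zero]
    exact fun q hq => by rw [hfd q hq, hfd p hp]
  obtain ⟨V, hV, -, hVmin⟩ := hmin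
  obtain ⟨I, hI, z₀, rfl⟩ := exists_eq_slicePoint p
  have hz₀ : z₀ ∈ D := (hmem I hI z₀).1 hp
  have hfz₀ := hrep I hI z₀ hz₀
  have hn₀ : stemNorm (a z₀) (b z₀) ≠ 0 := by
    refine stemNorm_ne_zero hI (hfz₀ ▸ hfp) (norm_mul_le_of_eventually ?_)
    have hcont : ContinuousAt (fun u : ℍ => slicePoint (u⁻¹ * I * u) z₀) 1 := by
      have : ContinuousAt (fun u : ℍ => u⁻¹) 1 := continuousAt_inv₀ one_ne_zero
      unfold slicePoint
      fun_prop
    have hV' : V ∈ 𝓝 (slicePoint ((1 : ℍ)⁻¹ * I * 1) z₀) := by simpa using hV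
    filter_upwards [hcont.eventually_mem hV', eventually_ne_nhds one_ne_zero] with u huV hu
    have h1 := hVmin _ huV
    rw [hfz₀, hrep _ (QSphere.conj_mem hI hu) z₀ hz₀] at h1
    have h2 : u * a z₀ + I * u * b z₀ = u * (a z₀ + u⁻¹ * I * u * b z₀) := by
      simp only [mul_add, ← mul_assoc, mul_inv_cancel₀ hu, one_mul]
    rw [h2, norm_mul]
    exact mul_le_mul_of_nonneg_left h1 (norm_nonneg _)
  obtain ⟨J, hJdef⟩ : ∃ J, J = (f (slicePoint I z₀))⁻¹ * I * f (slicePoint I z₀) := ⟨_, rfl⟩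
  have hJ : J ∈ QSphere := hJdef ▸ QSphere.conj_mem hI hfp
  let φ : ℂ → ℍ := fun z => star (a z) + J * star (b z)
  let n : ℂ → ℂ := fun z => stemNorm (a z) (b z)
  have hφ : ∀ z ∈ D, SliceHolomorphicAt J φ z := fun z hz => (hstem z hz).star.sliceHolomorphicAt hJ
  have hn : ∀ z ∈ D, DifferentiableAt ℂ n z := fun z hz => (hstem z hz).differentiableAt_stemNorm
  have hφ₀ : f (slicePoint I z₀) * φ z₀ = slicePoint I (n z₀) := by
    rw [← mul_conjugate_add hI, ← hfz₀]
    simp only [φ, hJdef, mul_add, ← mul_assoc, mul_inv_cancel₀ hfp, one_mul]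
  have hφne : ∀ z, n z ≠ 0 → φ z ≠ 0 := fun z hnz h0 => by
    have h1 := conjugate_mul_add hJ (a z) (b z)
    rw [show star (a z) + J * star (b z) = 0 from h0] at h1
    have h2 := norm_slicePoint hJ (n z)
    rw [← h1] at h2
    simp only [zero_mul, mul_zero, add_zero, norm_zero] at h2
    exact hnz (norm_eq_zero.1 h2.symm)
  have hT₀ : (φ z₀)⁻¹ * J * φ z₀ = I := by
    have h1 : J * φ z₀ = φ z₀ * I := by
      refine mul_left_cancel₀ hfp ?_
      calc f (slicePoint I z₀) * (J * φ z₀)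
          = I * (f (slicePoint I z₀) * φ z₀) := by
            simp only [hJdef, ← mul_assoc, mul_inv_cancel₀ hfp, one_mul]
        _ = f (slicePoint I z₀) * (φ z₀ * I) := by
            rw [hφ₀, ← (slicePoint_commute I (n z₀)).eq, ← hφ₀, mul_assoc]
    rw [mul_assoc, h1, ← mul_assoc, inv_mul_cancel₀ (hφne z₀ hn₀), one_mul]
  have hφcont : ContinuousAt φ z₀ := by
    obtain ⟨L, hL, -⟩ := hφ z₀ hz₀
    exact hL.continuousAt
  have hTcont : ContinuousAt (fun z => slicePoint ((φ z)⁻¹ * J * φ z) z) z₀ := by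
    have := hφcont.inv₀ (hφne z₀ hn₀)
    have h1 : Continuous fun z : ℂ => ((z.re : ℝ) : ℍ) :=
      Quaternion.continuous_coe.comp Complex.continuous_re
    exact h1.continuousAt.add (Complex.continuous_im.continuousAt.smul
      ((this.mul continuousAt_const).mul hφcont))
  have hnormφ : ∀ z ∈ D, n z ≠ 0 →
      ‖φ z‖ * ‖f (slicePoint ((φ z)⁻¹ * J * φ z) z)‖ = ‖n z‖ := fun z hz hnz => by
    have hφz := hφne z hnz
    rw [hrep _ (QSphere.conj_mem hJ hφz) z hz, ← norm_mul, ← norm_slicePoint hJ,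
      ← conjugate_mul_add hJ, mul_add, ← mul_assoc, ← mul_assoc, ← mul_assoc,
      mul_inv_cancel₀ hφz, one_mul]
  have hev : ∀ᶠ z in 𝓝 z₀, z ∈ D ∧ n z ≠ 0 :=
    (hD.eventually_mem hz₀).and ((hn z₀ hz₀).continuousAt.eventually_ne hn₀)
  let g : ℂ → ℍ := fun z => slicePoint J (n z)⁻¹ * φ z
  have hnormg : ∀ z ∈ D, n z ≠ 0 →
      ‖g z‖ = ‖f (slicePoint ((φ z)⁻¹ * J * φ z) z)‖⁻¹ := fun z hz hnz => by
    have h1 := hnormφ z hz hnz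
    have h2 : ‖φ z‖ ≠ 0 := norm_ne_zero_iff.2 (hφne z hnz)
    simp only [g]
    rw [norm_mul, norm_slicePoint hJ, norm_inv, ← h1, mul_inv, mul_comm ‖φ z‖⁻¹, mul_assoc,
      inv_mul_cancel₀ h2, mul_one]
  have hmax : IsLocalMax (norm ∘ g) z₀ := by
    have hV' : V ∈ 𝓝 (slicePoint ((φ z₀)⁻¹ * J * φ z₀) z₀) := by rwa [hT₀]
    filter_upwards [hev, hTcont.eventually_mem hV'] with z hz hzV
    simp only [Function.comp_apply]
    rw [hnormg z hz.1 hz.2, hnormg z₀ hz₀ hn₀, hT₀]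
    exact inv_anti₀ (norm_pos_iff.2 hfp) (hVmin _ hzV)
  have hgconst : ∀ᶠ z in 𝓝 z₀, g z = g z₀ :=
    SliceHolomorphicAt.eventually_eq_of_isLocalMax_norm hJ
      (hev.mono fun z hz => (hφ z hz.1).slicePoint_mul hJ ((hn z hz.1).inv hz.2)) hmax
  refine exists_forall_stem_eq hD hD' hconj ha hb hstem hJ hz₀ hn₀ (c := g z₀) ?_
  filter_upwards [hgconst, hev] with z hz hz'
  have h1 : slicePoint J (n z) * g z = φ z := by
    simp only [g]
    rw [← mul_assoc, ← slicePoint_mul hJ, mul_inv_cancel₀ hz'.2, slicePoint_one, one_mul]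
  rw [← hz]
  exact h1.symm
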